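/- Let d ≥ 1 be an integer and 0 < δ ≤ 1. There exists a constant c > 0, depending only on d and δ, such that for every measurable function f : ℝ^d × ℝ^d → [0,1] supported in [0,1]^d × [0,1]^d with ∫_{[0,1]^{2d}} f ≥ δ, one has ∫_{([0,1]^d)^3} f(x,y) f(x+s,y) f(x,y+s) ds dx dy ≥ c. -/

import Mathlib

open MeasureTheory

open Finset in
/-- The corners theorem in `ℕ × ℕ` with a positive common difference. -/
theorem exists_pos_corner (ε : ℝ) (hε : 0 < ε) :
    ∃ n : ℕ, 0 < n ∧ ∀ A : Finset (ℕ × ℕ), A ⊆ range n ×ˢ range n → ε * n ^ 2 ≤ #A →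
      ∃ i j k, 0 < k ∧ (i, j) ∈ A ∧ (i + k, j) ∈ A ∧ (i, j + k) ∈ A := by
  set ε' : ℝ := ε ^ 2 / 4 with hε'
  have hε'0 : 0 < ε' := by positivity
  obtain ⟨n, hn⟩ : ∃ n, n = cornersTheoremBound (ε' / 9) := ⟨_, rfl⟩
  have hn0 : 0 < n := by simp [hn, cornersTheoremBound]
  refine ⟨n, hn0, fun A hA hcard ↦ ?_⟩
  -- By pigeonhole, `A` has a large intersection `B` with some reflection `t - A`.
  obtain ⟨t, -, ht⟩ : ∃ t ∈ range (2 * n) ×ˢ range (2 * n),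
      ε' * n ^ 2 ≤ #{p ∈ A ×ˢ A | p.1 + p.2 = t} := by
    refine exists_le_card_fiber_of_nsmul_le_card_of_maps_to (s := A ×ˢ A)
      (t := range (2 * n) ×ˢ range (2 * n)) (f := fun p ↦ p.1 + p.2) (b := ε' * n ^ 2) ?_ ?_ ?_
    · rintro ⟨p, q⟩ hpq
      have hp := hA (mem_product.1 hpq).1
      have hq := hA (mem_product.1 hpq).2
      simp only [mem_product, mem_range, Prod.fst_add, Prod.snd_add] at hp hq ⊢
      omega
    · exact ⟨(0, 0), by simp [hn0]⟩
    · simp only [card_product, card_range, nsmul_eq_mul]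
      push_cast
      calc (2 * n * (2 * n) : ℝ) * (ε' * n ^ 2) = (ε * n ^ 2) * (ε * n ^ 2) := by
            rw [hε']; ring
        _ ≤ (#A : ℝ) * #A := by gcongr
  set B := image Prod.fst {p ∈ A ×ˢ A | p.1 + p.2 = t} with hB
  have hBcard : #B = #{p ∈ A ×ˢ A | p.1 + p.2 = t} := by
    refine card_image_of_injOn ?_
    rintro ⟨p, q⟩ h ⟨p', q'⟩ h' heq
    simp only [coe_filter, Set.mem_ofPred_eq] at h h' heq
    subst heq
    have := h.2.trans h'.2.symm
    simpa using this
  have hmem : ∀ p ∈ B, p ∈ A ∧ ∃ q ∈ A, p + q = t := by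
    intro p hp
    obtain ⟨⟨p, q⟩, h, rfl⟩ := mem_image.1 hp
    simp only [mem_filter, mem_product] at h
    exact ⟨h.1.1, q, h.1.2, h.2⟩
  have hfree := corners_theorem_nat hε'0 hn.ge B
    (fun p hp ↦ hA (hmem p hp).1) (by rw [hBcard]; exact ht)
  simp only [IsCornerFree, not_forall] at hfree
  obtain ⟨x₁, y₁, x₂, y₂, ⟨h₁, h₂, h₃, hadd⟩, hne⟩ := hfree
  obtain ⟨h₁, ⟨a₁, b₁⟩, hq₁, e₁⟩ := hmem _ h₁
  obtain ⟨h₂, ⟨a₂, b₂⟩, hq₂, e₂⟩ := hmem _ h₂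
  obtain ⟨h₃, ⟨a₃, b₃⟩, hq₃, e₃⟩ := hmem _ h₃
  simp only [Prod.ext_iff, Prod.fst_add, Prod.snd_add] at e₁ e₂ e₃
  rcases lt_or_gt_of_ne hne with h | h
  · refine ⟨x₁, y₁, x₂ - x₁, by omega, h₁, ?_, ?_⟩
    · convert h₃ using 2; omega
    · convert h₂ using 2; omega
  · refine ⟨a₁, b₁, x₁ - x₂, by omega, hq₁, ?_, ?_⟩
    · convert hq₃ using 2 <;> omega
    · convert hq₂ using 2 <;> omega

open Finset in
/-- A functional form of the corners theorem in `ℕ × ℕ`, with positive common differences. -/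
theorem exists_sum_corner_ge (ε : ℝ) (hε : 0 < ε) :
    ∃ n : ℕ, 0 < n ∧ ∃ c : ℝ, 0 < c ∧ ∀ g : ℕ → ℕ → ℝ, (∀ i j, g i j ∈ Set.Icc (0 : ℝ) 1) →
      c * (∑ i ∈ range n, ∑ j ∈ range n, g i j - ε * n ^ 2) ≤
        ∑ i ∈ range n, ∑ j ∈ range n, ∑ k ∈ Ico 1 n, g i j * g (i + k) j * g i (j + k) := by
  obtain ⟨n, hn, H⟩ := exists_pos_corner (ε / 2) (by positivity)
  have hn' : (0 : ℝ) < n := by exact_mod_cast hn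
  refine ⟨n, hn, (ε / 2) ^ 3 / n ^ 2, by positivity, fun g hg ↦ ?_⟩
  have hterm : ∀ i j k, 0 ≤ g i j * g (i + k) j * g i (j + k) := fun i j k ↦
    mul_nonneg (mul_nonneg (hg _ _).1 (hg _ _).1) (hg _ _).1
  have hnn : 0 ≤ ∑ i ∈ range n, ∑ j ∈ range n, ∑ k ∈ Ico 1 n,
      g i j * g (i + k) j * g i (j + k) :=
    sum_nonneg fun i _ ↦ sum_nonneg fun j _ ↦ sum_nonneg fun k _ ↦ hterm i j k
  rcases le_or_gt (∑ i ∈ range n, ∑ j ∈ range n, g i j) (ε * n ^ 2) with hle | hlt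
  · exact (mul_nonpos_of_nonneg_of_nonpos (by positivity) (by linarith)).trans hnn
  set A := {p ∈ range n ×ˢ range n | ε / 2 ≤ g p.1 p.2} with hA
  have hsum : ∑ i ∈ range n, ∑ j ∈ range n, g i j ≤ #A + ε / 2 * n ^ 2 := by
    rw [← sum_product']
    calc ∑ p ∈ range n ×ˢ range n, g p.1 p.2
        ≤ ∑ p ∈ range n ×ˢ range n, ((if ε / 2 ≤ g p.1 p.2 then 1 else 0) + ε / 2) := by
          refine sum_le_sum fun p _ ↦ ?_
          have := (hg p.1 p.2).2
          split_ifs <;> linarith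
      _ = #A + ε / 2 * n ^ 2 := by
          rw [sum_add_distrib, sum_boole, sum_const, card_product, card_range]
          simp only [nsmul_eq_mul, hA]
          push_cast
          ring
  obtain ⟨i, j, k, hk, h₁, h₂, h₃⟩ := H A (filter_subset _ _) (by linarith)
  simp only [hA, mem_filter, mem_product, mem_range] at h₁ h₂ h₃
  have hle : ∑ i ∈ range n, ∑ j ∈ range n, g i j ≤ n ^ 2 := by
    calc ∑ i ∈ range n, ∑ j ∈ range n, g i j ≤ ∑ i ∈ range n, ∑ j ∈ range n, (1 : ℝ) :=
          sum_le_sum fun i _ ↦ sum_le_sum fun j _ ↦ (hg i j).2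
      _ = n ^ 2 := by simp [sq]
  calc (ε / 2) ^ 3 / n ^ 2 * (∑ i ∈ range n, ∑ j ∈ range n, g i j - ε * n ^ 2)
      ≤ (ε / 2) ^ 3 / n ^ 2 * n ^ 2 := by
        have : 0 ≤ ε * (n : ℝ) ^ 2 := by positivity
        gcongr
        linarith
    _ = ε / 2 * (ε / 2) * (ε / 2) := by field_simp
    _ ≤ g i j * g (i + k) j * g i (j + k) := by
        have h0 := (hg i j).1
        have h0' := (hg (i + k) j).1
        gcongr
        · exact h₁.2
        · exact h₂.2
        · exact h₃.2
    _ ≤ ∑ k ∈ Ico 1 n, g i j * g (i + k) j * g i (j + k) :=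
        single_le_sum (f := fun k ↦ g i j * g (i + k) j * g i (j + k))
          (fun k _ ↦ hterm i j k) (by simp; omega)
    _ ≤ ∑ j ∈ range n, ∑ k ∈ Ico 1 n, g i j * g (i + k) j * g i (j + k) :=
        single_le_sum (f := fun j ↦ ∑ k ∈ Ico 1 n, g i j * g (i + k) j * g i (j + k))
          (fun j _ ↦ sum_nonneg fun k _ ↦ hterm i j k) (by simp; omega)
    _ ≤ _ :=
        single_le_sum
          (f := fun i ↦ ∑ j ∈ range n, ∑ k ∈ Ico 1 n, g i j * g (i + k) j * g i (j + k))
          (fun i _ ↦ sum_nonneg fun j _ ↦ sum_nonneg fun k _ ↦ hterm i j k) (by simp; omega)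

/-- The product of the values of `f` at the three vertices of the corner at `z` of size `s`. -/
def cornerProd {E : Type*} [Add E] (f : E × E → ℝ) (s : E) (z : E × E) : ℝ :=
  f z * f (z.1 + s, z.2) * f (z.1, z.2 + s)

section cornerProd

variable {d : ℕ} {f : (Fin d → ℝ) × (Fin d → ℝ) → ℝ}

lemma measurable_cornerProd (hf : Measurable f) :
    Measurable fun p : (Fin d → ℝ) × ((Fin d → ℝ) × (Fin d → ℝ)) ↦ cornerProd f p.1 p.2 := by
  unfold cornerProd
  fun_prop

lemma cornerProd_nonneg {E : Type*} [Add E] {f : E × E → ℝ} (h01 : ∀ z, f z ∈ Set.Icc (0 : ℝ) 1)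
    (s : E) (z : E × E) : 0 ≤ cornerProd f s z :=
  mul_nonneg (mul_nonneg (h01 _).1 (h01 _).1) (h01 _).1

lemma cornerProd_le {E : Type*} [Add E] {f : E × E → ℝ} (h01 : ∀ z, f z ∈ Set.Icc (0 : ℝ) 1)
    (s : E) (z : E × E) : cornerProd f s z ≤ f z :=
  (mul_le_of_le_one_right (mul_nonneg (h01 _).1 (h01 _).1) (h01 _).2).trans
    (mul_le_of_le_one_right (h01 _).1 (h01 _).2)

lemma integrable_cornerProd (hf : Measurable f) (h01 : ∀ z, f z ∈ Set.Icc (0 : ℝ) 1)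
    (hfi : Integrable f) (s : Fin d → ℝ) : Integrable (cornerProd f s) :=
  hfi.mono' ((measurable_cornerProd hf).comp measurable_prodMk_left).aestronglyMeasurable
    (.of_forall fun z ↦ by
      rw [Real.norm_of_nonneg (cornerProd_nonneg h01 s z)]
      exact cornerProd_le h01 s z)

/-- Averaging the finite corners bound over all translates of a grid with step `u`. -/
lemma le_sum_integral_cornerProd (hf : Measurable f) (h01 : ∀ z, f z ∈ Set.Icc (0 : ℝ) 1)
    (hfi : Integrable f)
    (hsupp : ∀ z, f z ≠ 0 → z ∈ Set.Icc (0 : Fin d → ℝ) 1 ×ˢ Set.Icc (0 : Fin d → ℝ) 1)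
    {n : ℕ} {c ε : ℝ}
    (H : ∀ g : ℕ → ℕ → ℝ, (∀ i j, g i j ∈ Set.Icc (0 : ℝ) 1) →
      c * (∑ i ∈ Finset.range n, ∑ j ∈ Finset.range n, g i j - ε * n ^ 2) ≤
        ∑ i ∈ Finset.range n, ∑ j ∈ Finset.range n, ∑ k ∈ Finset.Ico 1 n,
          g i j * g (i + k) j * g i (j + k))
    {u : Fin d → ℝ} (hu : u ∈ Set.Icc (0 : Fin d → ℝ) (fun _ ↦ (n : ℝ)⁻¹)) :
    c * (n ^ 2 * (∫ z, f z) - ε * n ^ 2 * volume.real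
        (Set.Icc (-1 : Fin d → ℝ) 1 ×ˢ Set.Icc (-1 : Fin d → ℝ) 1)) ≤
      n ^ 2 * ∑ k ∈ Finset.Ico 1 n, ∫ z, cornerProd f ((k : ℝ) • u) z := by
  have hinv : (volume : Measure ((Fin d → ℝ) × (Fin d → ℝ))).IsAddRightInvariant :=
    inferInstanceAs (Measure.prod volume volume).IsAddRightInvariant
  set B := Set.Icc (-1 : Fin d → ℝ) 1 ×ˢ Set.Icc (-1 : Fin d → ℝ) 1 with hB
  have hBm : MeasurableSet B := measurableSet_Icc.prod measurableSet_Icc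
  have hBfin : volume B ≠ ⊤ := (isCompact_Icc.prod isCompact_Icc).measure_lt_top.ne
  set w : ℕ → ℕ → (Fin d → ℝ) × (Fin d → ℝ) := fun i j ↦ ((i : ℝ) • u, (j : ℝ) • u) with hw
  have hstep : ∀ i < n, ∀ x : Fin d → ℝ, x + (i : ℝ) • u ∈ Set.Icc (0 : Fin d → ℝ) 1 →
      x ∈ Set.Icc (-1 : Fin d → ℝ) 1 := by
    intro i hi x hx
    have hn : (0 : ℝ) < n := by exact_mod_cast (Nat.zero_le i).trans_lt hi
    have key : ∀ a, 0 ≤ (i : ℝ) * u a ∧ (i : ℝ) * u a ≤ 1 := by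
      intro a
      have h0 : 0 ≤ u a := hu.1 a
      have h1 : u a ≤ (n : ℝ)⁻¹ := hu.2 a
      refine ⟨by positivity, ?_⟩
      calc (i : ℝ) * u a ≤ n * (n : ℝ)⁻¹ := by gcongr
        _ = 1 := mul_inv_cancel₀ hn.ne'
    constructor <;> intro a
    · have := hx.1 a
      have := (key a).2
      simp at *
      linarith
    · have := hx.2 a
      have := (key a).1
      simp at *
      linarith
  have hpt : ∀ z, c * (∑ i ∈ Finset.range n, ∑ j ∈ Finset.range n, f (z + w i j)
        - B.indicator (fun _ ↦ ε * n ^ 2) z) ≤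
      ∑ i ∈ Finset.range n, ∑ j ∈ Finset.range n, ∑ k ∈ Finset.Ico 1 n,
        cornerProd f ((k : ℝ) • u) (z + w i j) := by
    intro z
    by_cases hz : z ∈ B
    · rw [Set.indicator_of_mem hz]
      refine (H (fun i j ↦ f (z + w i j)) fun i j ↦ h01 _).trans_eq ?_
      refine Finset.sum_congr rfl fun i _ ↦ Finset.sum_congr rfl fun j _ ↦
        Finset.sum_congr rfl fun k _ ↦ ?_
      simp only [cornerProd, hw]
      congr 3 <;> ext <;> simp <;> ring
    · rw [Set.indicator_of_notMem hz, Finset.sum_eq_zero, sub_zero, mul_zero]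
      · exact Finset.sum_nonneg fun i _ ↦ Finset.sum_nonneg fun j _ ↦
          Finset.sum_nonneg fun k _ ↦ cornerProd_nonneg h01 _ _
      · refine fun i hi ↦ Finset.sum_eq_zero fun j hj ↦ ?_
        by_contra hne
        have := hsupp _ hne
        exact hz ⟨hstep i (Finset.mem_range.1 hi) _ this.1,
          hstep j (Finset.mem_range.1 hj) _ this.2⟩
  have hI : ∀ i j, Integrable fun z ↦ f (z + w i j) := fun i j ↦ hfi.comp_add_right _
  have hC : ∀ i j k, Integrable fun z ↦ cornerProd f ((k : ℕ) • u) (z + w i j) := fun i j k ↦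
    (integrable_cornerProd hf h01 hfi _).comp_add_right _
  simp only [← Nat.cast_smul_eq_nsmul ℝ] at hC
  have hind : Integrable (B.indicator fun _ ↦ ε * (n : ℝ) ^ 2) :=
    (integrable_indicator_iff hBm).2 (integrableOn_const hBfin)
  have hS : Integrable fun z ↦ ∑ i ∈ Finset.range n, ∑ j ∈ Finset.range n, f (z + w i j) :=
    integrable_finsetSum _ fun i _ ↦ integrable_finsetSum _ fun j _ ↦ hI i j
  have hmono := integral_mono ((hS.sub hind).const_mul c)
    (integrable_finsetSum _ fun i _ ↦ integrable_finsetSum _ fun j _ ↦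
      integrable_finsetSum _ fun k _ ↦ hC i j k) hpt
  have hL : ∫ z, c * (∑ i ∈ Finset.range n, ∑ j ∈ Finset.range n, f (z + w i j)
        - B.indicator (fun _ ↦ ε * (n : ℝ) ^ 2) z) =
      c * (n ^ 2 * (∫ z, f z) - ε * n ^ 2 * volume.real B) := by
    rw [integral_const_mul, integral_sub hS hind, integral_indicator hBm, setIntegral_const,
      integral_finsetSum _ fun i _ ↦ integrable_finsetSum _ fun j _ ↦ hI i j]
    simp_rw [integral_finsetSum _ fun j _ ↦ hI _ j, integral_add_right_eq_self f]
    simp only [Finset.sum_const, Finset.card_range, nsmul_eq_mul, smul_eq_mul]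
    ring
  have hR : ∫ z, ∑ i ∈ Finset.range n, ∑ j ∈ Finset.range n, ∑ k ∈ Finset.Ico 1 n,
        cornerProd f ((k : ℝ) • u) (z + w i j) =
      n ^ 2 * ∑ k ∈ Finset.Ico 1 n, ∫ z, cornerProd f ((k : ℝ) • u) z := by
    rw [integral_finsetSum _ fun i _ ↦ integrable_finsetSum _ fun j _ ↦
      integrable_finsetSum _ fun k _ ↦ hC i j k]
    simp_rw [integral_finsetSum _ fun j _ ↦ integrable_finsetSum _ fun k _ ↦ hC _ j k,
      integral_finsetSum _ fun k _ ↦ hC _ _ k,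
      integral_add_right_eq_self (cornerProd f _)]
    simp only [Finset.sum_const, Finset.card_range, nsmul_eq_mul]
    ring
  exact hL.symm.le.trans (hmono.trans hR.le)

open scoped Pointwise in
lemma setIntegral_comp_smul_le {J : (Fin d → ℝ) → ℝ} (hJ0 : ∀ s, 0 ≤ J s)
    (hJi : IntegrableOn J (Set.Icc 0 1)) {n k : ℕ} (hk : 1 ≤ k) (hkn : k ≤ n) :
    ∫ u in Set.Icc (0 : Fin d → ℝ) (fun _ ↦ (n : ℝ)⁻¹), J ((k : ℝ) • u) ≤
      ∫ s in Set.Icc (0 : Fin d → ℝ) 1, J s := by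
  have hk0 : (1 : ℝ) ≤ k := by exact_mod_cast hk
  have hkn' : (k : ℝ) ≤ n := by exact_mod_cast hkn
  have hn : (0 : ℝ) < n := by linarith
  rw [Measure.setIntegral_comp_smul_of_pos _ _ _ (by linarith), smul_eq_mul]
  have hsub : (k : ℝ) • Set.Icc (0 : Fin d → ℝ) (fun _ ↦ (n : ℝ)⁻¹) ⊆ Set.Icc 0 1 := by
    rintro _ ⟨u, hu, rfl⟩
    constructor <;> intro a
    · exact mul_nonneg (by linarith) (hu.1 a)
    · have h0 : 0 ≤ u a := hu.1 a
      have h1 : u a ≤ (n : ℝ)⁻¹ := hu.2 a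
      calc (k : ℝ) * u a ≤ n * (n : ℝ)⁻¹ := by gcongr
        _ = 1 := mul_inv_cancel₀ hn.ne'
  calc _ ≤ ∫ s in (k : ℝ) • Set.Icc (0 : Fin d → ℝ) (fun _ ↦ (n : ℝ)⁻¹), J s :=
        mul_le_of_le_one_left (integral_nonneg hJ0) (inv_le_one_of_one_le₀ (one_le_pow₀ hk0))
    _ ≤ _ := setIntegral_mono_set hJi (.of_forall hJ0) hsub.eventuallyLE

lemma integral_corner_eq (hf : Measurable f) (h01 : ∀ z, f z ∈ Set.Icc (0 : ℝ) 1)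
    (hfi : Integrable f)
    (hsupp : ∀ z, f z ≠ 0 → z ∈ Set.Icc (0 : Fin d → ℝ) 1 ×ˢ Set.Icc (0 : Fin d → ℝ) 1) :
    ∫ x in Set.Icc (0 : Fin d → ℝ) 1, ∫ y in Set.Icc (0 : Fin d → ℝ) 1,
        ∫ s in Set.Icc (0 : Fin d → ℝ) 1, f (x, y) * f (x + s, y) * f (x, y + s) =
      ∫ s in Set.Icc (0 : Fin d → ℝ) 1, ∫ z, cornerProd f s z := by
  have : IsFiniteMeasure (volume.restrict (Set.Icc (0 : Fin d → ℝ) 1)) :=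
    ⟨by simpa using isCompact_Icc.measure_lt_top⟩
  have hint : Integrable (Function.uncurry (cornerProd f))
      ((volume.restrict (Set.Icc (0 : Fin d → ℝ) 1)).prod volume) :=
    (hfi.comp_snd _).mono' (measurable_cornerProd hf).aestronglyMeasurable
      (.of_forall fun p ↦ by
        rw [Function.uncurry, Real.norm_of_nonneg (cornerProd_nonneg h01 _ _)]
        exact cornerProd_le h01 _ _)
  rw [integral_integral_swap hint, ← setIntegral_eq_integral_of_forall_compl_eq_zero
    (s := Set.Icc (0 : Fin d → ℝ) 1 ×ˢ Set.Icc (0 : Fin d → ℝ) 1), Measure.volume_eq_prod,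
    setIntegral_prod]
  · rfl
  · rw [← Measure.volume_eq_prod]
    exact hint.integral_prod_right.integrableOn
  · intro z hz
    have : f z = 0 := by_contra fun h ↦ hz (hsupp z h)
    simp [cornerProd, this]

end cornerProd

theorem corners_in_unit_box (d : ℕ) (hd : 1 ≤ d) (δ : ℝ) (hδ0 : 0 < δ) (hδ1 : δ ≤ 1) :
    ∃ c : ℝ, 0 < c ∧
      ∀ f : (Fin d → ℝ) × (Fin d → ℝ) → ℝ, Measurable f →
        (∀ z, f z ∈ Set.Icc (0 : ℝ) 1) →
        (∀ z, f z ≠ 0 →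
          z ∈ Set.Icc (0 : Fin d → ℝ) 1 ×ˢ Set.Icc (0 : Fin d → ℝ) 1) →
        δ ≤ ∫ z : (Fin d → ℝ) × (Fin d → ℝ), f z →
        c ≤ ∫ x in Set.Icc (0 : Fin d → ℝ) 1, ∫ y in Set.Icc (0 : Fin d → ℝ) 1,
              ∫ s in Set.Icc (0 : Fin d → ℝ) 1,
                f (x, y) * f (x + s, y) * f (x, y + s) := by
  set V := volume.real (Set.Icc (-1 : Fin d → ℝ) 1 ×ˢ Set.Icc (-1 : Fin d → ℝ) 1) with hV
  have hV0 : 0 ≤ V := measureReal_nonneg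
  set ε := δ / (2 * (V + 1)) with hε
  have hεV : ε * V ≤ δ / 2 := by
    rw [hε, div_mul_eq_mul_div, div_le_div_iff₀ (by positivity) two_pos]
    nlinarith
  obtain ⟨n, hn, c, hc, H⟩ := exists_sum_corner_ge ε (by positivity)
  have hn' : (0 : ℝ) < n := by exact_mod_cast hn
  set U := Set.Icc (0 : Fin d → ℝ) (fun _ ↦ (n : ℝ)⁻¹) with hU
  have hUfin : volume U ≠ ⊤ := isCompact_Icc.measure_lt_top.ne
  have hUvol : 0 < volume.real U := by
    rw [measureReal_def, hU, Real.volume_Icc_pi_toReal fun _ ↦ by simp]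
    exact Finset.prod_pos fun i _ ↦ by simpa using hn
  refine ⟨volume.real U * (c * (δ / 2)) / n, by positivity, fun f hf h01 hsupp hδf ↦ ?_⟩
  have hfi : Integrable f := by
    by_contra h
    rw [integral_undef h] at hδf
    linarith
  rw [integral_corner_eq hf h01 hfi hsupp]
  set J : (Fin d → ℝ) → ℝ := fun s ↦ ∫ z, cornerProd f s z with hJ
  have hJ0 : ∀ s, 0 ≤ J s := fun s ↦ integral_nonneg (cornerProd_nonneg h01 s)
  have hJle : ∀ s, J s ≤ ∫ z, f z := fun s ↦
    integral_mono (integrable_cornerProd hf h01 hfi s) hfi (cornerProd_le h01 s)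
  have hJm : Measurable J :=
    (measurable_cornerProd hf).stronglyMeasurable.integral_prod_right.measurable
  have hJi : ∀ (k : ℝ) (S : Set (Fin d → ℝ)), volume S ≠ ⊤ →
      IntegrableOn (fun u ↦ J (k • u)) S := fun k S hS ↦
    (integrableOn_const (C := ∫ z, f z) hS).mono'
      (hJm.comp (measurable_const_smul k)).aestronglyMeasurable
      (.of_forall fun u ↦ by
        rw [Real.norm_of_nonneg (hJ0 _)]
        exact hJle _)
  have hJQ : IntegrableOn J (Set.Icc 0 1) := by
    simpa using hJi 1 (Set.Icc 0 1) isCompact_Icc.measure_lt_top.ne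
  have hlow : ∀ u ∈ U, c * (δ / 2) ≤ ∑ k ∈ Finset.Ico 1 n, J ((k : ℝ) • u) := by
    intro u hu
    have h := le_sum_integral_cornerProd hf h01 hfi hsupp H hu
    rw [← hV] at h
    refine le_of_mul_le_mul_left (le_trans ?_ h) (by positivity : (0 : ℝ) < n ^ 2)
    calc (n : ℝ) ^ 2 * (c * (δ / 2)) = c * (n ^ 2 * (δ / 2)) := by ring
      _ ≤ c * (n ^ 2 * ((∫ z, f z) - ε * V)) := by gcongr; linarith
      _ = _ := by ring
  rw [div_le_iff₀ hn']
  calc volume.real U * (c * (δ / 2)) = ∫ _ in U, c * (δ / 2) := by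
        rw [setIntegral_const, smul_eq_mul]
    _ ≤ ∫ u in U, ∑ k ∈ Finset.Ico 1 n, J ((k : ℝ) • u) :=
        setIntegral_mono_on (integrableOn_const hUfin)
          (integrable_finsetSum _ fun k _ ↦ hJi k U hUfin) measurableSet_Icc hlow
    _ = ∑ k ∈ Finset.Ico 1 n, ∫ u in U, J ((k : ℝ) • u) :=
        integral_finsetSum _ fun k _ ↦ hJi k U hUfin
    _ ≤ ∑ k ∈ Finset.Ico 1 n, ∫ s in Set.Icc (0 : Fin d → ℝ) 1, J s := by
        refine Finset.sum_le_sum fun k hk ↦ ?_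
        rw [Finset.mem_Ico] at hk
        exact setIntegral_comp_smul_le hJ0 hJQ hk.1 hk.2.le
    _ ≤ (∫ s in Set.Icc (0 : Fin d → ℝ) 1, J s) * n := by
        rw [Finset.sum_const, Nat.card_Ico, nsmul_eq_mul, mul_comm]
        have : 0 ≤ ∫ s in Set.Icc (0 : Fin d → ℝ) 1, J s := integral_nonneg hJ0
        gcongr
        omega
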